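/- arXiv:0806.1698 — 2 statements merged into one kernel-verified Lean document; each statement's English description precedes it below -/
import Mathlib

section
/- Suppose u, v : ℝ × ℝ → ℝ are continuously differentiable (with u additionally C¹ so that u_x exists) and satisfy the potential system of the Burgers equation: v_x = u and v_t = u_x + u² on an open set Ω. Define ṽ := e^v and ũ := u·e^v. Then on Ω one has ṽ_x = ũ and ṽ_t = ũ_x; consequently ṽ is a solution of the linear heat equation ṽ_t = ṽ_{xx}, and the transformation t̃ = t, x̃ = x, ũ = u·e^v, ṽ = e^v maps the potential system of the Burgers equation u_t = u_{xx} + 2uu_x to the potential system of the linear heat equation associated with the characteristic 1. -/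
/-- Partial derivative with respect to the first (time) variable. -/
noncomputable def dt (u : ℝ × ℝ → ℝ) (p : ℝ × ℝ) : ℝ := deriv (fun s => u (s, p.2)) p.1

/-- Partial derivative with respect to the second (space) variable. -/
noncomputable def dx (u : ℝ × ℝ → ℝ) (p : ℝ × ℝ) : ℝ := deriv (fun y => u (p.1, y)) p.2

theorem hasDerivAt_dt {u : ℝ × ℝ → ℝ} {p : ℝ × ℝ} (hu : DifferentiableAt ℝ u p) :
    HasDerivAt (fun s => u (s, p.2)) (dt u p) p.1 :=
  (DifferentiableAt.fun_comp' (g := u) (f := fun s : ℝ => (s, p.2)) p.1 hu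
    (by fun_prop)).hasDerivAt

theorem hasDerivAt_dx {u : ℝ × ℝ → ℝ} {p : ℝ × ℝ} (hu : DifferentiableAt ℝ u p) :
    HasDerivAt (fun y => u (p.1, y)) (dx u p) p.2 :=
  (DifferentiableAt.fun_comp' (g := u) (f := fun y : ℝ => (p.1, y)) p.2 hu
    (by fun_prop)).hasDerivAt

theorem dt_exp {v : ℝ × ℝ → ℝ} {p : ℝ × ℝ} (hv : DifferentiableAt ℝ v p) :
    dt (fun q => Real.exp (v q)) p = Real.exp (v p) * dt v p :=
  (hasDerivAt_dt hv).exp.deriv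

theorem dx_exp {v : ℝ × ℝ → ℝ} {p : ℝ × ℝ} (hv : DifferentiableAt ℝ v p) :
    dx (fun q => Real.exp (v q)) p = Real.exp (v p) * dx v p :=
  (hasDerivAt_dx hv).exp.deriv

theorem dx_mul_exp {u v : ℝ × ℝ → ℝ} {p : ℝ × ℝ} (hu : DifferentiableAt ℝ u p)
    (hv : DifferentiableAt ℝ v p) :
    dx (fun q => u q * Real.exp (v q)) p
      = dx u p * Real.exp (v p) + u p * (Real.exp (v p) * dx v p) :=
  ((hasDerivAt_dx hu).mul (hasDerivAt_dx hv).exp).deriv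

theorem dx_congr_of_eqOn {f g : ℝ × ℝ → ℝ} {Ω : Set (ℝ × ℝ)} (hΩ : IsOpen Ω)
    (h : Set.EqOn f g Ω) {p : ℝ × ℝ} (hp : p ∈ Ω) : dx f p = dx g p := by
  have hc : Continuous fun y : ℝ => (p.1, y) := by fun_prop
  refine Filter.EventuallyEq.deriv_eq ?_
  filter_upwards [(hΩ.preimage hc).mem_nhds hp] with y hy using h hy

/-- The transformation `t̃ = t`, `x̃ = x`, `ũ = u e^v`, `ṽ = e^v` maps the potential
system `v_x = u`, `v_t = u_x + u²` of the Burgers equation `u_t = u_xx + 2 u u_x` to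
the potential system `ṽ_x = ũ`, `ṽ_t = ũ_x` of the linear heat equation; in
particular `ṽ` solves `ṽ_t = ṽ_xx`. -/
theorem burgers_potential_to_heat (u v : ℝ × ℝ → ℝ) (Ω : Set (ℝ × ℝ)) (hΩ : IsOpen Ω)
    (hu : ContDiff ℝ 1 u) (hv : ContDiff ℝ 1 v)
    (hvx : ∀ p ∈ Ω, dx v p = u p)
    (hvt : ∀ p ∈ Ω, dt v p = dx u p + u p ^ 2) :
    ∀ p ∈ Ω,
      dx (fun q => Real.exp (v q)) p = u p * Real.exp (v p) ∧
      dt (fun q => Real.exp (v q)) p = dx (fun q => u q * Real.exp (v q)) p ∧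
      dt (fun q => Real.exp (v q)) p
        = dx (fun q => dx (fun r => Real.exp (v r)) q) p := by
  have hu' : Differentiable ℝ u := hu.differentiable one_ne_zero
  have hv' : Differentiable ℝ v := hv.differentiable one_ne_zero
  have hx : Set.EqOn (fun q => dx (fun r => Real.exp (v r)) q)
      (fun q => u q * Real.exp (v q)) Ω := fun q hq => by
    simp only [dx_exp (hv' q), hvx q hq, mul_comm]
  intro p hp
  have ht : dt (fun q => Real.exp (v q)) p = dx (fun q => u q * Real.exp (v q)) p := by
    rw [dt_exp (hv' p), dx_mul_exp (hu' p) (hv' p), hvx p hp, hvt p hp]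
    ring
  exact ⟨hx hp, ht, ht.trans (dx_congr_of_eqOn hΩ hx hp).symm⟩
end

section
/- Let n ≠ 0, n ≠ -1 be real, let ε = ±1, and suppose u : ℝ × ℝ → ℝ is a twice continuously differentiable positive solution of u_t = (u^n)_{xx} + ε·(x·u)_x. Define, for s with ε(n+1)s > 0, T(s) := ln(ε(n+1)s)/(ε(n+1)) and w(s, y) := e^{-εT(s)}·u(T(s), e^{-εT(s)}·y). Then w is a solution of the constant coefficient porous medium equation w_s = (w^n)_{yy} on the corresponding domain; i.e., the transformation t̃ = e^{ε(n+1)t}/(ε(n+1)), x̃ = e^{εt}x, ũ = e^{-εt}u reduces u_t = (u^n)_{xx} + ε(xu)_x to ũ_{t̃} = (ũ^n)_{x̃x̃}. -/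
/-- The inverse time reparametrization `t = T(s) = ln(ε(n+1)s)/(ε(n+1))`. -/
noncomputable def timeT (n ε s : ℝ) : ℝ := Real.log (ε * (n + 1) * s) / (ε * (n + 1))

/-- The transformed function `w(s, y) = e^{-εT(s)} u(T(s), e^{-εT(s)} y)`. -/
noncomputable def transfW (n ε : ℝ) (u : ℝ × ℝ → ℝ) (p : ℝ × ℝ) : ℝ :=
  Real.exp (-(ε * timeT n ε p.1)) * u (timeT n ε p.1, Real.exp (-(ε * timeT n ε p.1)) * p.2)

theorem HasFDerivAt.dt_eq {u : ℝ × ℝ → ℝ} {L : ℝ × ℝ →L[ℝ] ℝ} {p : ℝ × ℝ}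
    (h : HasFDerivAt u L p) : dt u p = L (1, 0) :=
  (h.comp_hasDerivAt (x := p.1) (f := fun s => (s, p.2))
    ((hasDerivAt_id p.1).prodMk (hasDerivAt_const p.1 p.2))).deriv

theorem HasFDerivAt.hasDerivAt_snd {u : ℝ × ℝ → ℝ} {L : ℝ × ℝ →L[ℝ] ℝ} {p : ℝ × ℝ}
    (h : HasFDerivAt u L p) : HasDerivAt (fun y => u (p.1, y)) (L (0, 1)) p.2 :=
  h.comp_hasDerivAt (x := p.2) (f := fun y => (p.1, y))
    ((hasDerivAt_const p.2 p.1).prodMk (hasDerivAt_id p.2))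

theorem dx_mul_snd {u : ℝ × ℝ → ℝ} {L : ℝ × ℝ →L[ℝ] ℝ} {p : ℝ × ℝ}
    (h : HasFDerivAt u L p) (ε : ℝ) :
    dx (fun q => ε * (q.2 * u q)) p = ε * (u p + p.2 * L (0, 1)) := by
  have h1 := (((hasDerivAt_id p.2).mul h.hasDerivAt_snd).const_mul ε).deriv
  exact h1.trans (by simp)

/-- The time change `T` has derivative `e^{-ε(n+1)T(s)}` at `s`. -/
theorem hasDerivAt_timeT {n ε s : ℝ} (hs : 0 < ε * (n + 1) * s) :
    HasDerivAt (timeT n ε) (Real.exp (-(ε * (n + 1) * timeT n ε s))) s := by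
  have hc : ε * (n + 1) ≠ 0 := left_ne_zero_of_mul hs.ne'
  have hs0 : s ≠ 0 := right_ne_zero_of_mul hs.ne'
  have h := (((hasDerivAt_id s).const_mul (ε * (n + 1))).log hs.ne').div_const (ε * (n + 1))
  refine h.congr_deriv ?_
  rw [timeT, mul_div_cancel₀ _ hc, Real.exp_neg, Real.exp_log hs]
  simp only [id]
  field_simp

/-- The time derivative of the transformed function, by the chain rule. -/
theorem dt_transfW {n ε : ℝ} {u : ℝ × ℝ → ℝ} {p : ℝ × ℝ} (hp : 0 < ε * (n + 1) * p.1)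
    {L : ℝ × ℝ →L[ℝ] ℝ}
    (hL : HasFDerivAt u L (timeT n ε p.1, Real.exp (-(ε * timeT n ε p.1)) * p.2)) :
    dt (transfW n ε u) p =
      Real.exp (-(ε * timeT n ε p.1)) * Real.exp (-(ε * (n + 1) * timeT n ε p.1)) *
        (L (1, 0) - ε * (u (timeT n ε p.1, Real.exp (-(ε * timeT n ε p.1)) * p.2) +
          Real.exp (-(ε * timeT n ε p.1)) * p.2 * L (0, 1))) := by
  have hT := hasDerivAt_timeT hp
  have hE := (hT.const_mul ε).neg.exp
  have hU := hL.comp_hasDerivAt (x := p.1)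
    (f := fun s => (timeT n ε s, Real.exp (-(ε * timeT n ε s)) * p.2))
    (hT.prodMk (hE.mul_const p.2))
  have hlin (a b : ℝ) : L (a, b) = a * L (1, 0) + b * L (0, 1) := by
    rw [← smul_eq_mul, ← smul_eq_mul, ← map_smul, ← map_smul, ← map_add]
    simp
  refine (hE.mul hU).deriv.trans ?_
  rw [hlin]
  simp only [Function.comp_apply, Pi.neg_apply]
  ring

/-- Rescaling amplitude and space rescales the second space derivative of a power. -/
theorem dx_dx_transfW_rpow {n ε : ℝ} {u : ℝ × ℝ → ℝ} (hu : ∀ p, 0 < u p) (p : ℝ × ℝ) :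
    dx (fun q => dx (fun r => transfW n ε u r ^ n) q) p =
      Real.exp (-(ε * timeT n ε p.1)) * Real.exp (-(ε * (n + 1) * timeT n ε p.1)) *
        dx (fun q => dx (fun r => u r ^ n) q)
          (timeT n ε p.1, Real.exp (-(ε * timeT n ε p.1)) * p.2) := by
  have hexp : Real.exp (-(ε * (n + 1) * timeT n ε p.1)) =
      Real.exp (-(ε * timeT n ε p.1)) ^ n * Real.exp (-(ε * timeT n ε p.1)) := by
    rw [← Real.exp_mul, ← Real.exp_add]
    ring_nf
  rw [hexp]
  simp only [dx, transfW]
  generalize timeT n ε p.1 = T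
  have hpos := Real.exp_pos (-(ε * T))
  generalize Real.exp (-(ε * T)) = c at hpos ⊢
  have hpow (y : ℝ) : (c * u (T, c * y)) ^ n = c ^ n * u (T, c * y) ^ n :=
    Real.mul_rpow hpos.le (hu _).le
  have hscale (f : ℝ → ℝ) (y : ℝ) : deriv (fun z => f (c * z)) y = c * deriv f (c * y) := by
    rw [deriv_comp_mul_left, smul_eq_mul]
  have hfirst (y : ℝ) : deriv (fun z => u (T, c * z) ^ n) y =
      c * deriv (fun z => u (T, z) ^ n) (c * y) :=
    hscale (fun z => u (T, z) ^ n) y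
  simp only [hpow, deriv_const_mul_field, hfirst]
  rw [hscale (deriv fun z => u (T, z) ^ n)]
  ring

/-- The transformation `t̃ = e^{ε(n+1)t}/(ε(n+1))`, `x̃ = e^{εt} x`, `ũ = e^{-εt} u`
reduces `u_t = (u^n)_xx + ε (x u)_x` to the constant coefficient porous medium
equation `ũ_t̃ = (ũ^n)_x̃x̃`. -/
theorem time_scaling_reduction (n : ℝ) (hn0 : n ≠ 0) (hn1 : n ≠ -1)
    (ε : ℝ) (hε : ε = 1 ∨ ε = -1)
    (u : ℝ × ℝ → ℝ) (hu : ContDiff ℝ 2 u) (hupos : ∀ p : ℝ × ℝ, 0 < u p)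
    (heq : ∀ p : ℝ × ℝ,
      dt u p = dx (fun q => dx (fun r => u r ^ n) q) p
        + dx (fun q => ε * (q.2 * u q)) p) :
    ∀ p : ℝ × ℝ, 0 < ε * (n + 1) * p.1 →
      dt (transfW n ε u) p
        = dx (fun q => dx (fun r => transfW n ε u r ^ n) q) p := by
  intro p hp
  have hL := (hu.differentiable (by norm_num)
    (timeT n ε p.1, Real.exp (-(ε * timeT n ε p.1)) * p.2)).hasFDerivAt
  rw [dt_transfW hp hL, dx_dx_transfW_rpow hupos, ← hL.dt_eq, heq, dx_mul_snd hL]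
  ring
end
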